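/- Fix N ≥ 2 and work on the N-qubit Hilbert space ℂ^(2^N). Let Φ = (|0…0⟩ + |1…1⟩)/√2 be the generalized GHZ state, let L_j (j = 1,…,N) be the local damping operators acting as |0⟩⟨1| on qubit j and as the identity on all other qubits, and let D be the associated dissipator. Suppose ρ = p·ΦΦ† + (1−p)·σ where p ∈ [0,1] and σ is a density matrix with σΦ = 0. If ⟨Φ, D(ρ)Φ⟩ = 0 (the spectral stabilizability condition for the eigenvector Φ), then p ≤ 1/(N+1). -/

import Mathlib

open Matrix
open scoped ComplexOrder

/-- The local damping operator `|0⟩⟨1|` on qubit `j`. -/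
def damping {N : ℕ} (j : Fin N) : Matrix (Fin N → Fin 2) (Fin N → Fin 2) ℂ :=
  fun s t => if t j = 1 ∧ s = Function.update t j 0 then 1 else 0

/-- The generalized GHZ vector. -/
noncomputable def ghz (N : ℕ) : (Fin N → Fin 2) → ℂ :=
  fun s => if s = (fun _ => 0) then ((Real.sqrt 2)⁻¹ : ℂ)
    else if s = (fun _ => 1) then ((Real.sqrt 2)⁻¹ : ℂ) else 0

theorem inv_sqrt_two_mul_self : ((Real.sqrt 2)⁻¹ : ℂ) * ((Real.sqrt 2)⁻¹ : ℂ) = 1 / 2 := by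
  rw [← mul_inv, ← Complex.ofReal_mul, Real.mul_self_sqrt (by norm_num)]
  norm_num

theorem star_inv_sqrt_two : star ((Real.sqrt 2)⁻¹ : ℂ) = ((Real.sqrt 2)⁻¹ : ℂ) := by
  simp

theorem zero_ne_one_string {N : ℕ} (hN : N ≠ 0) :
    (fun _ => 0 : Fin N → Fin 2) ≠ fun _ => 1 := fun h => by
  simpa using congrFun h ⟨0, Nat.pos_of_ne_zero hN⟩

theorem ghz_eq {N : ℕ} (hN : N ≠ 0) :
    ghz N = ((Real.sqrt 2)⁻¹ : ℂ) •
      (Pi.single (fun _ => 0) 1 + Pi.single (fun _ => 1) 1) := by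
  have h := zero_ne_one_string hN
  ext s
  by_cases h0 : s = fun _ => 0
  · subst h0
    simp [ghz, h]
  · simp [ghz, Pi.single_apply, h0]

theorem star_ghz_dotProduct_self {N : ℕ} (hN : N ≠ 0) : star (ghz N) ⬝ᵥ ghz N = 1 := by
  have h := zero_ne_one_string hN
  rw [ghz_eq hN, star_smul, star_inv_sqrt_two, smul_dotProduct, dotProduct_smul, smul_smul,
    inv_sqrt_two_mul_self]
  simp [h, h.symm, dotProduct_add]
  norm_num

theorem damping_conjTranspose_mulVec_ghz {N : ℕ} (j : Fin N) :
    (damping j)ᴴ *ᵥ ghz N =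
      ((Real.sqrt 2)⁻¹ : ℂ) • Pi.single (Function.update (fun _ => 0) j 1) 1 := by
  rw [ghz_eq (Fin.pos j).ne', mulVec_smul, mulVec_add, mulVec_single_one, mulVec_single_one]
  congr 1
  ext t
  have h1 : (fun _ => 1) ≠ Function.update t j 0 := fun h => by
    simpa using congrFun h j
  have h0 : (t j = 1 ∧ (fun _ => 0) = Function.update t j 0) ↔
      t = Function.update (fun _ => 0) j 1 := by
    simp only [Function.eq_update_iff]
    grind
  simp [damping, Pi.single_apply, h1, h0, apply_ite]

theorem damping_mulVec_ghz {N : ℕ} (j : Fin N) :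
    damping j *ᵥ ghz N =
      ((Real.sqrt 2)⁻¹ : ℂ) • Pi.single (Function.update (fun _ => 1) j 0) 1 := by
  rw [ghz_eq (Fin.pos j).ne', mulVec_smul, mulVec_add, mulVec_single_one, mulVec_single_one]
  congr 1
  ext t
  simp [damping, Pi.single_apply]

/-- The expectation of a dissipator term in an eigenvector of a Hermitian matrix. -/
theorem star_dotProduct_dissipator_mulVec {n : Type*} [Fintype n] (A M : Matrix n n ℂ)
    (hM : M.IsHermitian) (v : n → ℂ) (p : ℝ) (hv : M *ᵥ v = (p : ℂ) • v) :
    star v ⬝ᵥ ((A * M * Aᴴ - (1/2 : ℂ) • (Aᴴ * A * M + M * (Aᴴ * A))) *ᵥ v) =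
      star (Aᴴ *ᵥ v) ⬝ᵥ (M *ᵥ (Aᴴ *ᵥ v)) - p * (star (A *ᵥ v) ⬝ᵥ (A *ᵥ v)) := by
  have hv' : star v ᵥ* M = (p : ℂ) • star v := by
    have := congrArg star hv
    rw [star_mulVec, hM.eq, star_smul] at this
    simpa using this
  simp only [sub_mulVec, smul_mulVec, add_mulVec, ← mulVec_mulVec, hv, mulVec_smul,
    dotProduct_sub, dotProduct_smul, dotProduct_add, star_mulVec, conjTranspose_conjTranspose,
    dotProduct_mulVec _ M (Aᴴ *ᵥ (A *ᵥ v)), hv', smul_dotProduct, smul_eq_mul]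
  simp only [dotProduct_mulVec]
  ring

theorem stmt_8 {N : ℕ} (hN : 2 ≤ N)
    (Φ : (Fin N → Fin 2) → ℂ)
    (hΦ : Φ = fun s => if s = (fun _ => 0) then ((Real.sqrt 2)⁻¹ : ℂ)
      else if s = (fun _ => 1) then ((Real.sqrt 2)⁻¹ : ℂ) else 0)
    (L : Fin N → Matrix (Fin N → Fin 2) (Fin N → Fin 2) ℂ)
    (hL : ∀ j, L j = fun s t =>
      if t j = 1 ∧ s = Function.update t j 0 then 1 else 0)
    (D : Matrix (Fin N → Fin 2) (Fin N → Fin 2) ℂ →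
      Matrix (Fin N → Fin 2) (Fin N → Fin 2) ℂ)
    (hD : ∀ M, D M = ∑ j, (L j * M * (L j)ᴴ
      - (1/2 : ℂ) • ((L j)ᴴ * L j * M + M * ((L j)ᴴ * L j))))
    (p : ℝ) (hp0 : 0 ≤ p) (hp1 : p ≤ 1)
    (σ : Matrix (Fin N → Fin 2) (Fin N → Fin 2) ℂ)
    (hσPSD : σ.PosSemidef) (hσTr : σ.trace = 1) (hσΦ : σ *ᵥ Φ = 0)
    (ρ : Matrix (Fin N → Fin 2) (Fin N → Fin 2) ℂ)
    (hρ : ρ = (p : ℂ) • Matrix.vecMulVec Φ (star Φ) + ((1 : ℂ) - (p : ℂ)) • σ)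
    (hstab : star Φ ⬝ᵥ (D ρ *ᵥ Φ) = 0) :
    p ≤ 1 / ((N : ℝ) + 1) := by
  have hN0 : N ≠ 0 := by omega
  obtain rfl : Φ = ghz N := hΦ
  obtain rfl : L = damping := funext hL
  set e : Fin N → Fin N → Fin 2 := fun j => Function.update (fun _ => 0) j 1 with he
  have he_inj : Function.Injective e := fun i j hij => by
    by_contra hne
    simpa [he, hne] using congrFun hij i
  have hghz_e (j : Fin N) : ghz N (e j) = 0 := by
    have h0 : e j ≠ fun _ => 0 := fun h => by simpa [he] using congrFun h j
    have h1 : e j ≠ fun _ => 1 := fun h => by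
      have : Nontrivial (Fin N) := Fin.nontrivial_iff_two_le.mpr hN
      obtain ⟨i, hi⟩ := exists_ne j
      simpa [he, hi] using congrFun h i
    simp [ghz, h0, h1]
  have hρH : ρ.IsHermitian := by
    rw [hρ, IsHermitian, conjTranspose_add, conjTranspose_smul, conjTranspose_smul,
      conjTranspose_vecMulVec, hσPSD.isHermitian.eq]
    simp
  have hρv : ρ *ᵥ ghz N = (p : ℂ) • ghz N := by
    rw [hρ, add_mulVec, smul_mulVec, smul_mulVec, hσΦ, vecMulVec_mulVec,
      star_ghz_dotProduct_self hN0]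
    simp
  have hρe (j : Fin N) : ρ (e j) (e j) = (1 - p) * σ (e j) (e j) := by
    simp [hρ, vecMulVec_apply, hghz_e]
  have hterm (j : Fin N) : star (ghz N) ⬝ᵥ ((damping j * ρ * (damping j)ᴴ
      - (1/2 : ℂ) • ((damping j)ᴴ * damping j * ρ + ρ * ((damping j)ᴴ * damping j))) *ᵥ ghz N)
      = 1 / 2 * ((1 - p) * σ (e j) (e j) - p) := by
    rw [star_dotProduct_dissipator_mulVec _ _ hρH _ _ hρv, damping_conjTranspose_mulVec_ghz,
      damping_mulVec_ghz]
    simp only [star_smul, star_inv_sqrt_two, mulVec_smul, smul_dotProduct, dotProduct_smul,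
      smul_smul, inv_sqrt_two_mul_self, mulVec_single_one]
    rw [← hρe]
    simp [he]
    ring
  have hsum : (1 - p : ℂ) * ∑ j, σ (e j) (e j) = p * N := by
    rw [hD, sum_mulVec, dotProduct_sum, Finset.sum_congr rfl fun j _ => hterm j,
      ← Finset.mul_sum, Finset.sum_sub_distrib, ← Finset.mul_sum] at hstab
    simp at hstab
    linear_combination hstab
  have hle : ∑ j, (σ (e j) (e j)).re ≤ 1 := by
    have hnn (s) : 0 ≤ (σ s s).re := (Complex.le_def.mp hσPSD.diag_nonneg).1
    have htr : ∑ s, (σ s s).re = 1 := by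
      rw [← Complex.re_sum]
      exact congrArg Complex.re hσTr
    rw [← htr, ← Finset.sum_image (s := Finset.univ) (f := fun s => (σ s s).re)
      he_inj.injOn]
    exact Finset.sum_le_sum_of_subset_of_nonneg (Finset.subset_univ _) fun s _ _ => hnn s
  have hre : (1 - p) * ∑ j, (σ (e j) (e j)).re = p * N := by
    have := congrArg Complex.re hsum
    rw [← Complex.ofReal_one, ← Complex.ofReal_sub, Complex.re_ofReal_mul, Complex.re_sum] at this
    simpa using this
  rw [le_div_iff₀ (by positivity)]
  nlinarith [mul_le_mul_of_nonneg_left hle (sub_nonneg.mpr hp1)]
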